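/- Let n ≥ 1, let (N_t)_{t∈ℝ} be a family of norms on ℝ^n, fix t ∈ ℝ and A ∈ ℝ^{n×n}. Suppose the partial differential p := limsup_{h→0+} (1/h) · sup_{N_t(x)=1} (N_{t+h}(x) − 1) is finite. Then the switched matrix measure ν_t(A) := limsup_{h→0+} (1/h) · sup_{N_t(x)=1} (N_{t+h}(x + h·A·x) − 1) is finite and satisfies ν_t(A) ≤ μ_t(A) + p, where μ_t is the matrix measure induced by the single norm N_t. -/

import Mathlib

open Filter Topology MeasureTheory

/-- `N` is a norm on `ℝ^n`. -/
structure IsNorm {n : ℕ} (N : (Fin n → ℝ) → ℝ) : Prop where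
  nonneg : ∀ x, 0 ≤ N x
  eq_zero_iff : ∀ x, N x = 0 ↔ x = 0
  norm_smul : ∀ (c : ℝ) (x : Fin n → ℝ), N (c • x) = |c| * N x
  triangle : ∀ x y, N (x + y) ≤ N x + N y

/-- Supremum of `N'` over the unit sphere of the norm `N`. -/
noncomputable def sphereSup {n : ℕ} (N N' : (Fin n → ℝ) → ℝ) : ℝ :=
  sSup (N' '' {x | N x = 1})

/-- Matrix measure (logarithmic norm) induced by the single norm `N`:
`μ(A) = lim_{h→0+} (sup_{N x = 1} N(x + hAx) − 1)/h` (the limit exists, so we may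
express it as a limsup). -/
noncomputable def matrixMeasure {n : ℕ} (N : (Fin n → ℝ) → ℝ)
    (A : Matrix (Fin n) (Fin n) ℝ) : ℝ :=
  Filter.limsup (fun h : ℝ =>
    (sphereSup N (fun x => N (x + h • A.mulVec x)) - 1) / h) (𝓝[>] (0:ℝ))

/-- Switched matrix measure with respect to the family of norms `N t`:
`ν_t(A) = limsup_{h→0+} (1/h)[ sup_{N_t(x)=1} N_{t+h}(x + hAx) − 1 ]`,
taken in the extended reals. -/
noncomputable def switchedMeasure {n : ℕ} (N : ℝ → (Fin n → ℝ) → ℝ) (t : ℝ)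
    (A : Matrix (Fin n) (Fin n) ℝ) : EReal :=
  Filter.limsup (fun h : ℝ =>
    (((sphereSup (N t) (fun x => N (t + h) (x + h • A.mulVec x)) - 1) / h : ℝ) : EReal))
    (𝓝[>] (0:ℝ))

namespace IsNorm

variable {n : ℕ} {N N' : (Fin n → ℝ) → ℝ}

/-- A norm as a bundled seminorm. -/
def toSeminorm (hN : IsNorm N) : Seminorm ℝ (Fin n → ℝ) :=
  Seminorm.of N hN.triangle fun c x => by rw [hN.norm_smul, Real.norm_eq_abs]

theorem toSeminorm_apply (hN : IsNorm N) (x : Fin n → ℝ) : hN.toSeminorm x = N x := rfl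

theorem continuous (hN : IsNorm N) : Continuous N :=
  hN.toSeminorm.convexOn.locallyLipschitz.continuous

theorem exists_eq_one (hN : IsNorm N) (hn : 1 ≤ n) : ∃ x, N x = 1 := by
  have : Nonempty (Fin n) := ⟨⟨0, hn⟩⟩
  obtain ⟨v, hv⟩ := exists_ne (0 : Fin n → ℝ)
  have hv' : N v ≠ 0 := fun h => hv ((hN.eq_zero_iff v).1 h)
  refine ⟨(N v)⁻¹ • v, ?_⟩
  rw [hN.norm_smul, abs_inv, abs_of_nonneg (hN.nonneg v), inv_mul_cancel₀ hv']

theorem exists_norm_le_mul (hN : IsNorm N) : ∃ C, 0 < C ∧ ∀ x, ‖x‖ ≤ C * N x := by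
  rcases subsingleton_or_nontrivial (Fin n → ℝ) with h | h
  · refine ⟨1, one_pos, fun x => ?_⟩
    rw [Subsingleton.elim x 0, norm_zero, one_mul]
    exact hN.nonneg 0
  obtain ⟨y, hy, hmin⟩ := (isCompact_sphere (0 : Fin n → ℝ) 1).exists_isMinOn
    (NormedSpace.sphere_nonempty.2 zero_le_one) hN.continuous.continuousOn
  have hy0 : y ≠ 0 := ne_zero_of_mem_unit_sphere ⟨y, hy⟩
  have hpos : 0 < N y := (hN.nonneg y).lt_of_ne' fun h => hy0 ((hN.eq_zero_iff y).1 h)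
  refine ⟨(N y)⁻¹, inv_pos.2 hpos, fun x => ?_⟩
  rcases eq_or_ne x 0 with rfl | hx
  · simpa using mul_nonneg (inv_nonneg.2 hpos.le) (hN.nonneg 0)
  have hx' : 0 < ‖x‖ := norm_pos_iff.2 hx
  have hle : N y ≤ N (‖x‖⁻¹ • x) := hmin (by simp [_root_.norm_smul, hx'.ne'])
  rw [hN.norm_smul, abs_inv, abs_norm, inv_mul_eq_div, le_div_iff₀ hx'] at hle
  rwa [inv_mul_eq_div, le_div_iff₀ hpos, mul_comm]

/-- Every seminorm on `ℝ^n` is bounded by a multiple of a given norm. -/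
theorem exists_seminorm_le_mul (hN : IsNorm N) (q : Seminorm ℝ (Fin n → ℝ)) :
    ∃ C, 0 ≤ C ∧ ∀ x, q x ≤ C * N x := by
  obtain ⟨C, hC, hqC⟩ := q.bound_of_continuous_normedSpace q.convexOn.locallyLipschitz.continuous
  obtain ⟨D, hD, hND⟩ := hN.exists_norm_le_mul
  refine ⟨C * D, by positivity, fun x => (hqC x).trans ?_⟩
  rw [mul_assoc]
  gcongr
  exact hND x

theorem exists_mulVec_le_mul (hN : IsNorm N) (A : Matrix (Fin n) (Fin n) ℝ) :
    ∃ K, 0 ≤ K ∧ ∀ x, N (A.mulVec x) ≤ K * N x :=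
  hN.exists_seminorm_le_mul (hN.toSeminorm.comp A.mulVecLin)

theorem bddAbove_image_sphere (hN : IsNorm N) (hN' : IsNorm N') :
    BddAbove (N' '' {x | N x = 1}) := by
  obtain ⟨C, -, hC⟩ := hN.exists_seminorm_le_mul hN'.toSeminorm
  refine ⟨C, ?_⟩
  rintro _ ⟨x, hx, rfl⟩
  simpa [toSeminorm_apply, hx.out] using hC x

theorem le_sphereSup_mul (hN : IsNorm N) (hN' : IsNorm N') (x : Fin n → ℝ) :
    N' x ≤ sphereSup N N' * N x := by
  rcases eq_or_ne x 0 with rfl | hx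
  · rw [(hN.eq_zero_iff 0).2 rfl, (hN'.eq_zero_iff 0).2 rfl, mul_zero]
  have hpos : 0 < N x := (hN.nonneg x).lt_of_ne' fun h => hx ((hN.eq_zero_iff x).1 h)
  have hle : N' ((N x)⁻¹ • x) ≤ sphereSup N N' :=
    le_csSup (hN.bddAbove_image_sphere hN') ⟨_, by
      simp [hN.norm_smul, abs_of_pos hpos, hpos.ne'], rfl⟩
  rwa [hN'.norm_smul, abs_inv, abs_of_pos hpos, inv_mul_eq_div, div_le_iff₀ hpos] at hle

theorem sphereSup_nonneg (hN' : IsNorm N') : 0 ≤ sphereSup N N' :=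
  Real.sSup_nonneg (by rintro _ ⟨x, -, rfl⟩; exact hN'.nonneg x)

theorem sphereSup_le (hN : IsNorm N) (hn : 1 ≤ n) {f : (Fin n → ℝ) → ℝ} {C : ℝ}
    (h : ∀ x, N x = 1 → f x ≤ C) : sphereSup N f ≤ C := by
  obtain ⟨v, hv⟩ := hN.exists_eq_one hn
  refine csSup_le ⟨f v, v, hv, rfl⟩ ?_
  rintro _ ⟨x, hx, rfl⟩
  exact h x hx

theorem sphereSup_self (hN : IsNorm N) (hn : 1 ≤ n) : sphereSup N N = 1 := by
  obtain ⟨v, hv⟩ := hN.exists_eq_one hn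
  refine le_antisymm (hN.sphereSup_le hn fun x hx => hx.le) ?_
  simpa [hv] using hN.le_sphereSup_mul hN v

variable {A : Matrix (Fin n) (Fin n) ℝ} {K h : ℝ}

theorem add_smul_mulVec_le (hN : IsNorm N) (hK : ∀ x, N (A.mulVec x) ≤ K * N x) (hh : 0 ≤ h)
    {x : Fin n → ℝ} (hx : N x = 1) : N (x + h • A.mulVec x) ≤ 1 + h * K := by
  refine (hN.triangle _ _).trans ?_
  rw [hN.norm_smul, abs_of_nonneg hh, hx]
  have := hK x
  rw [hx, mul_one] at this
  gcongr

theorem le_sphereSup_add_smul_mulVec (hN : IsNorm N) (hN' : IsNorm N')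
    (hK : ∀ x, N (A.mulVec x) ≤ K * N x) (hh : 0 ≤ h) {x : Fin n → ℝ} (hx : N x = 1) :
    N' (x + h • A.mulVec x) ≤ sphereSup N (fun x => N' (x + h • A.mulVec x)) := by
  refine le_csSup ⟨sphereSup N N' * (1 + h * K), ?_⟩ ⟨x, hx, rfl⟩
  rintro _ ⟨y, hy, rfl⟩
  exact (hN.le_sphereSup_mul hN' _).trans
    (mul_le_mul_of_nonneg_left (hN.add_smul_mulVec_le hK hh hy) hN'.sphereSup_nonneg)

theorem sphereSup_add_smul_mulVec_le (hN : IsNorm N) (hn : 1 ≤ n)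
    (hK : ∀ x, N (A.mulVec x) ≤ K * N x) (hh : 0 ≤ h) :
    sphereSup N (fun x => N (x + h • A.mulVec x)) ≤ 1 + h * K :=
  hN.sphereSup_le hn fun _ hx => hN.add_smul_mulVec_le hK hh hx

theorem sphereSup_add_smul_mulVec_le_mul (hN : IsNorm N) (hN' : IsNorm N') (hn : 1 ≤ n)
    (hK : ∀ x, N (A.mulVec x) ≤ K * N x) (hh : 0 ≤ h) :
    sphereSup N (fun x => N' (x + h • A.mulVec x)) ≤
      sphereSup N N' * sphereSup N (fun x => N (x + h • A.mulVec x)) :=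
  hN.sphereSup_le hn fun _ hx => (hN.le_sphereSup_mul hN' _).trans
    (mul_le_mul_of_nonneg_left (hN.le_sphereSup_add_smul_mulVec hN hK hh hx)
      hN'.sphereSup_nonneg)

theorem sphereSup_mul_le_sphereSup_add_smul_mulVec (hN : IsNorm N) (hN' : IsNorm N') (hn : 1 ≤ n)
    (hK : ∀ x, N (A.mulVec x) ≤ K * N x) (hh : 0 ≤ h) :
    sphereSup N N' * (1 - h * K) ≤ sphereSup N (fun x => N' (x + h • A.mulVec x)) := by
  have key : sphereSup N N' ≤
      sphereSup N (fun x => N' (x + h • A.mulVec x)) + h * (sphereSup N N' * K) := by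
    refine hN.sphereSup_le hn fun x hx => ?_
    have h₁ := hN.le_sphereSup_add_smul_mulVec hN' hK hh hx
    have h₂ : N' (A.mulVec x) ≤ sphereSup N N' * K :=
      (hN.le_sphereSup_mul hN' _).trans
        (mul_le_mul_of_nonneg_left (by simpa [hx] using hK x) hN'.sphereSup_nonneg)
    have h₃ := hN'.triangle (x + h • A.mulVec x) ((-h) • A.mulVec x)
    rw [hN'.norm_smul, abs_neg, abs_of_nonneg hh, neg_smul, add_neg_cancel_right] at h₃
    have h₄ := mul_le_mul_of_nonneg_left h₂ hh
    linarith
  linarith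

end IsNorm

/-- if the partial differential
`p = limsup_{h→0+} (1/h) sup_{N_t(x)=1}(N_{t+h}(x) − 1)` is finite, then the switched
matrix measure `ν_t(A)` is finite and `ν_t(A) ≤ μ_t(A) + p`. -/
theorem switchedMeasure_le_matrixMeasure_add_partial
    {n : ℕ} (hn : 1 ≤ n) (N : ℝ → (Fin n → ℝ) → ℝ) (hN : ∀ s, IsNorm (N s))
    (t : ℝ) (A : Matrix (Fin n) (Fin n) ℝ) (p : EReal)
    (hp : p = Filter.limsup (fun h : ℝ =>
      (((sphereSup (N t) (N (t + h)) - 1) / h : ℝ) : EReal)) (𝓝[>] (0:ℝ)))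
    (hpfin : p ≠ ⊤ ∧ p ≠ ⊥) :
    switchedMeasure N t A ≠ ⊤ ∧ switchedMeasure N t A ≠ ⊥ ∧
      switchedMeasure N t A ≤ ((matrixMeasure (N t) A : ℝ) : EReal) + p := by
  lift p to ℝ using hpfin
  obtain ⟨K, hK0, hK⟩ := (hN t).exists_mulVec_le_mul A
  have upper : ∀ a : ℝ, p < a → ∀ᶠ h in 𝓝[>] (0 : ℝ),
      (sphereSup (N t) (N (t + h)) - 1) / h < a := by
    intro a ha
    have := eventually_lt_of_limsup_lt (hp.symm.trans_lt (EReal.coe_lt_coe_iff.2 ha))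
    exact this.mono fun h hh => EReal.coe_lt_coe_iff.1 hh
  have lower : ∃ᶠ h in 𝓝[>] (0 : ℝ), p - 1 < (sphereSup (N t) (N (t + h)) - 1) / h := by
    have := frequently_lt_of_lt_limsup (by isBoundedDefault)
      ((EReal.coe_lt_coe_iff.2 (sub_one_lt p)).trans_eq hp)
    exact this.mono fun h hh => EReal.coe_lt_coe_iff.1 hh
  have small : ∀ c : ℝ, 0 < c → ∀ᶠ h in 𝓝[>] (0 : ℝ), 0 < h ∧ h < c := fun c hc =>
    Ioo_mem_nhdsGT hc
  have hbdd : IsBoundedUnder (· ≤ ·) (𝓝[>] (0 : ℝ)) fun h : ℝ =>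
      (sphereSup (N t) (fun x => N t (x + h • A.mulVec x)) - 1) / h := by
    refine isBoundedUnder_of_eventually_le (a := K) ?_
    filter_upwards [self_mem_nhdsWithin] with h hh
    rw [div_le_iff₀ hh]
    linarith [(hN t).sphereSup_add_smul_mulVec_le hn hK (le_of_lt hh)]
  have hle : switchedMeasure N t A ≤ ((matrixMeasure (N t) A : ℝ) : EReal) + p := by
    rw [← EReal.coe_add, ← EReal.le_of_forall_lt_iff_le]
    intro z hz
    rw [EReal.coe_lt_coe_iff] at hz
    obtain ⟨δ, hδ, hzδ⟩ : ∃ δ, 0 < δ ∧ z = matrixMeasure (N t) A + p + 3 * δ :=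
      ⟨(z - (matrixMeasure (N t) A + p)) / 3, by linarith, by ring⟩
    have hq := eventually_lt_of_limsup_lt (lt_add_of_pos_right (matrixMeasure (N t) A) hδ) hbdd
    refine limsup_le_of_le (by isBoundedDefault) ?_
    filter_upwards [hq, upper (p + δ) (by linarith),
      small (δ / (K * |p + δ| + 1)) (by positivity)] with h hq hr hh
    obtain ⟨h0, hsmall⟩ := hh
    rw [EReal.coe_le_coe_iff, div_le_iff₀ h0]
    rw [div_lt_iff₀ h0] at hq hr
    rw [lt_div_iff₀ (by positivity)] at hsmall
    have hs := (hN t).sphereSup_add_smul_mulVec_le_mul (hN (t + h)) hn hK h0.le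
    have hm := (hN t).sphereSup_add_smul_mulVec_le hn hK h0.le
    have hm' := (hN t).sphereSup_mul_le_sphereSup_add_smul_mulVec (hN t) hn hK h0.le
    rw [(hN t).sphereSup_self hn, one_mul] at hm'
    have hm0 : 0 ≤ sphereSup (N t) (fun x => N t (x + h • A.mulVec x)) :=
      Real.sSup_nonneg (by rintro _ ⟨x, -, rfl⟩; exact (hN t).nonneg _)
    generalize sphereSup (N t) (fun x => N t (x + h • A.mulVec x)) = m at *
    generalize sphereSup (N t) (N (t + h)) = M at *
    have hmδ : (m - 1) * (p + δ) ≤ δ := by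
      have : |m - 1| ≤ h * K := abs_le.2 ⟨by linarith, by linarith⟩
      calc (m - 1) * (p + δ) ≤ |m - 1| * |p + δ| := (le_abs_self _).trans_eq (abs_mul _ _)
        _ ≤ h * K * |p + δ| := by gcongr
        _ ≤ δ := by linarith
    have h₁ := mul_le_mul_of_nonneg_right hr.le hm0
    have h₂ := mul_le_mul_of_nonneg_right hmδ h0.le
    rw [hzδ]
    linarith
  refine ⟨ne_top_of_le_ne_top (EReal.coe_ne_top (matrixMeasure (N t) A + p)) hle, ?_, hle⟩
  have hge : ((p - 1 - 2 * K : ℝ) : EReal) ≤ switchedMeasure N t A := by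
    refine le_limsup_of_frequently_le' ?_
    refine (lower.and_eventually ((upper (p + 1) (by linarith)).and
      (small (1 / (|p + 1| + 1)) (by positivity)))).mono ?_
    rintro h ⟨hl, hu, h0, hsmall⟩
    rw [EReal.coe_le_coe_iff, le_div_iff₀ h0]
    rw [lt_div_iff₀ h0] at hl
    rw [div_lt_iff₀ h0] at hu
    rw [lt_div_iff₀ (by positivity)] at hsmall
    have hs := (hN t).sphereSup_mul_le_sphereSup_add_smul_mulVec (hN (t + h)) hn hK h0.le
    have hM : sphereSup (N t) (N (t + h)) ≤ 2 := by
      linarith [mul_le_mul_of_nonneg_left (le_abs_self (p + 1)) h0.le]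
    have := mul_le_mul_of_nonneg_right hM (mul_nonneg h0.le hK0)
    linarith
  exact ne_bot_of_le_ne_bot (EReal.coe_ne_bot _) hge
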